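/- arXiv:math/0411129 — 2 statements merged into one kernel-verified Lean document; each statement's English description precedes it below -/
import Mathlib

section
/- Let A|B be a depth two ring extension. Realize E ⊗_{ρ(A)} E as the quotient of the tensor product of abelian groups E ⊗_ℤ E by the subgroup generated by {f((−)a) ⊗ g − f ⊗ g(−)a : f, g ∈ E, a ∈ A} (the tensor product over the subring ρ(A) ≅ A^op of E). Then the map E ⊗_{ρ(A)} E → Hom(_B A⊗_B A, _B A) sending f⊗g to the map induced by a⊗a′ ↦ f(a·g(a′)) is well defined and bijective. (Under the identification S ⊗_R E ≅ Hom(_B A⊗_B A, _B A) given by a right D2 quasibase, this map is the Galois map β(f⊗g) = f₍₋₁₎ ⊗ f₍₀₎∘g of the coaction ϱ(f) = Σ_j γ_j ⊗ u_j¹f(u_j²−); thus E is a left S-Galois extension of ρ(A).) -/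
noncomputable section

open TensorProduct

variable (A : Type*) [Ring A] (B : Subring A)

/-- The `B`-balancing relations in `A ⊗_ℤ A`, realizing `A ⊗_B A` as a quotient of the
tensor product of abelian groups. -/
def relB : AddSubgroup (A ⊗[ℤ] A) :=
  AddSubgroup.closure {z | ∃ a a' b : A, b ∈ B ∧ z = (a * b) ⊗ₜ[ℤ] a' - a ⊗ₜ[ℤ] (b * a')}

/-- `A ⊗_B A`. -/
abbrev QB := (A ⊗[ℤ] A) ⧸ relB A B

/-- The canonical quotient map `A ⊗_ℤ A → A ⊗_B A`. -/
def mkB : A ⊗[ℤ] A →+ QB A B := QuotientAddGroup.mk' _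

theorem lmul_aux (c : A) :
    relB A B ≤ (relB A B).comap (LinearMap.rTensor A (LinearMap.mulLeft ℤ c)).toAddMonoidHom := by
  rw [relB, AddSubgroup.closure_le]
  rintro z ⟨a, a', b, hb, rfl⟩
  simp only [SetLike.mem_coe, AddSubgroup.mem_comap, LinearMap.toAddMonoidHom_coe, map_sub,
    LinearMap.rTensor_tmul, LinearMap.mulLeft_apply]
  rw [← mul_assoc]
  exact AddSubgroup.subset_closure ⟨c * a, a', b, hb, rfl⟩

theorem rmul_aux (c : A) :
    relB A B ≤ (relB A B).comap (LinearMap.lTensor A (LinearMap.mulRight ℤ c)).toAddMonoidHom := by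
  rw [relB, AddSubgroup.closure_le]
  rintro z ⟨a, a', b, hb, rfl⟩
  simp only [SetLike.mem_coe, AddSubgroup.mem_comap, LinearMap.toAddMonoidHom_coe, map_sub,
    LinearMap.lTensor_tmul, LinearMap.mulRight_apply]
  rw [mul_assoc]
  exact AddSubgroup.subset_closure ⟨a, a' * c, b, hb, rfl⟩

/-- The left `A`-action on `A ⊗_B A` through the left tensorand. -/
def lmulB (c : A) : QB A B →+ QB A B :=
  QuotientAddGroup.map _ _ (LinearMap.rTensor A (LinearMap.mulLeft ℤ c)).toAddMonoidHom
    (lmul_aux A B c)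

/-- The right `A`-action on `A ⊗_B A` through the right tensorand. -/
def rmulB (c : A) : QB A B →+ QB A B :=
  QuotientAddGroup.map _ _ (LinearMap.lTensor A (LinearMap.mulRight ℤ c)).toAddMonoidHom
    (rmul_aux A B c)

/-- `E = End(_B A)`: the left `B`-linear additive endomorphisms of `A`. -/
def Egrp : AddSubgroup (A →+ A) where
  carrier := {f | ∀ b ∈ B, ∀ a : A, f (b * a) = b * f a}
  add_mem' := by
    intro f g hf hg b hb a
    simp [hf b hb a, hg b hb a, mul_add]
  zero_mem' := by intro b hb a; simp
  neg_mem' := by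
    intro f hf b hb a
    simp [hf b hb a]

/-- `S = End(_B A_B)`: the `B`-`B`-bilinear additive endomorphisms of `A`. -/
def Sgrp : AddSubgroup (A →+ A) where
  carrier := {f | ∀ b ∈ B, ∀ a : A, f (b * a) = b * f a ∧ f (a * b) = f a * b}
  add_mem' := by
    intro f g hf hg b hb a
    exact ⟨by simp [(hf b hb a).1, (hg b hb a).1, mul_add],
      by simp [(hf b hb a).2, (hg b hb a).2, add_mul]⟩
  zero_mem' := by intro b hb a; simp
  neg_mem' := by
    intro f hf b hb a
    exact ⟨by simp [(hf b hb a).1], by simp [(hf b hb a).2]⟩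

/-- `Hom(_B A ⊗_B A, _B A)`: additive maps `A ⊗_B A → A` which are left `B`-linear for the
`B`-action through the left tensorand. -/
def HomBQ : AddSubgroup (QB A B →+ A) where
  carrier := {F | ∀ b ∈ B, ∀ q : QB A B, F (lmulB A B b q) = b * F q}
  add_mem' := by
    intro F G hF hG b hb q
    simp [hF b hb q, hG b hb q, mul_add]
  zero_mem' := by intro b hb q; simp
  neg_mem' := by
    intro F hF b hb q
    simp [hF b hb q]

/-- The `ρ(A)`-balancing relations in `E ⊗_ℤ E`: `f((−)a) ⊗ g − f ⊗ g(−)a`, realizing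
`E ⊗_{ρ(A)} E` (the tensor product over the subring `ρ(A) ≅ A^op` of `E`). -/
def relEE : AddSubgroup (↥(Egrp A B) ⊗[ℤ] ↥(Egrp A B)) :=
  AddSubgroup.closure
    {z | ∃ (f f' g g' : ↥(Egrp A B)) (a : A),
      (∀ x : A, (f' : A →+ A) x = (f : A →+ A) (x * a)) ∧
      (∀ x : A, (g' : A →+ A) x = (g : A →+ A) x * a) ∧
      z = f' ⊗ₜ[ℤ] g - f ⊗ₜ[ℤ] g'}

variable {A B}

lemma lmulB_mkB_tmul (c a a' : A) :
    lmulB A B c (mkB A B (a ⊗ₜ[ℤ] a')) = mkB A B ((c * a) ⊗ₜ[ℤ] a') := rfl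

lemma tmul_addMonoidHom_ext {X Y M : Type*} [AddCommGroup X] [AddCommGroup Y] [AddZeroClass M]
    {F G : X ⊗[ℤ] Y →+ M} (h : ∀ x y, F (x ⊗ₜ[ℤ] y) = G (x ⊗ₜ[ℤ] y)) : F = G := by
  ext z
  induction z with
  | zero => simp
  | tmul x y => exact h x y
  | add x y hx hy => simp [hx, hy]

/-- Additive maps out of `A ⊗_B A` agree if they agree on pure tensors. -/
lemma QB_hom_ext {M : Type*} [AddMonoid M] {F G : QB A B →+ M}
    (h : ∀ a a' : A, F (mkB A B (a ⊗ₜ[ℤ] a')) = G (mkB A B (a ⊗ₜ[ℤ] a'))) : F = G :=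
  QuotientAddGroup.addMonoidHom_ext _ (tmul_addMonoidHom_ext h)

lemma lmulB_mul (c d : A) (q : QB A B) : lmulB A B (c * d) q = lmulB A B c (lmulB A B d q) := by
  suffices h : lmulB A B (c * d) = (lmulB A B c).comp (lmulB A B d) from DFunLike.congr_fun h q
  exact QB_hom_ext fun a a' => by simp [lmulB_mkB_tmul, mul_assoc]

lemma lmulB_add (c d : A) (q : QB A B) : lmulB A B (c + d) q = lmulB A B c q + lmulB A B d q := by
  suffices h : lmulB A B (c + d) = lmulB A B c + lmulB A B d from DFunLike.congr_fun h q
  exact QB_hom_ext fun a a' => by simp [lmulB_mkB_tmul, add_mul, TensorProduct.add_tmul]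

/-- The left `A`-linear map `A ⊗_B A → A`, `a ⊗ a' ↦ a g(a')`, induced by `g ∈ End(_B A)`. -/
def mulEnd (g : ↥(Egrp A B)) : QB A B →+ A :=
  QuotientAddGroup.lift (relB A B)
    (TensorProduct.liftAddHom (AddMonoidHom.mul.compl₂ (g : A →+ A))
      fun r a a' => by simp [-zsmul_eq_mul])
    (by
      rw [relB, AddSubgroup.closure_le]
      rintro _ ⟨a, a', b, hb, rfl⟩
      have h := g.2 b hb a'
      simp [AddMonoidHom.mem_ker, h, mul_assoc])

@[simp]
lemma mulEnd_mkB_tmul (g : ↥(Egrp A B)) (a a' : A) :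
    mulEnd g (mkB A B (a ⊗ₜ[ℤ] a')) = a * (g : A →+ A) a' := rfl

lemma mulEnd_lmulB (g : ↥(Egrp A B)) (c : A) (q : QB A B) :
    mulEnd g (lmulB A B c q) = c * mulEnd g q := by
  suffices h : (mulEnd g).comp (lmulB A B c) = (AddMonoidHom.mulLeft c).comp (mulEnd g) from
    DFunLike.congr_fun h q
  exact QB_hom_ext fun a a' => by simp [lmulB_mkB_tmul, mul_assoc]

lemma mulEnd_add (g h : ↥(Egrp A B)) : mulEnd (g + h) = mulEnd g + mulEnd h :=
  QB_hom_ext fun a a' => by simp [mul_add]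

/-- The biadditive map sending `(f, g)` to the map induced by `a ⊗ a' ↦ f(a g(a'))`. -/
def galoisBihom : ↥(Egrp A B) →+ ↥(Egrp A B) →+ ↥(HomBQ A B) :=
  AddMonoidHom.mk' (fun f => AddMonoidHom.mk'
      (fun g => ⟨(f : A →+ A).comp (mulEnd g), fun b hb q => by
        simpa [mulEnd_lmulB] using f.2 b hb _⟩)
      fun g h => by ext q; simp [mulEnd_add])
    fun f f' => by ext g q; simp

@[simp]
lemma galoisBihom_apply (f g : ↥(Egrp A B)) (q : QB A B) :
    (galoisBihom f g : QB A B →+ A) q = (f : A →+ A) (mulEnd g q) := rfl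

/-- The Galois map `E ⊗_{ρ(A)} E → Hom(_B A ⊗_B A, _B A)`. -/
def galoisMap : (↥(Egrp A B) ⊗[ℤ] ↥(Egrp A B)) ⧸ relEE A B →+ ↥(HomBQ A B) :=
  QuotientAddGroup.lift (relEE A B)
    (TensorProduct.liftAddHom galoisBihom fun r f g => by simp)
    (by
      rw [relEE, AddSubgroup.closure_le]
      rintro _ ⟨f, f', g, g', a, hf, hg, rfl⟩
      simp only [SetLike.mem_coe, AddMonoidHom.mem_ker, map_sub, TensorProduct.liftAddHom_tmul,
        sub_eq_zero]
      refine Subtype.ext (QB_hom_ext fun x y => ?_)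
      simp [hf, hg, mul_assoc])

@[simp]
lemma galoisMap_mk_tmul (f g : ↥(Egrp A B)) :
    galoisMap (QuotientAddGroup.mk' (relEE A B) (f ⊗ₜ[ℤ] g)) = galoisBihom f g := rfl

/-- The endomorphism `x ↦ F(x · v)` of `_B A` attached to `F ∈ Hom(_B A ⊗_B A, _B A)`. -/
def evalAt (v : QB A B) : ↥(HomBQ A B) →+ ↥(Egrp A B) :=
  AddMonoidHom.mk'
    (fun F => ⟨AddMonoidHom.mk' (fun x => (F : QB A B →+ A) (lmulB A B x v))
        fun x y => by simp [lmulB_add],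
      fun b hb x => by simpa [lmulB_mul] using F.2 b hb _⟩)
    fun F G => by ext x; simp

@[simp]
lemma evalAt_apply (v : QB A B) (F : ↥(HomBQ A B)) (x : A) :
    (evalAt v F : A →+ A) x = (F : QB A B →+ A) (lmulB A B x v) := rfl

lemma Sgrp_le_Egrp : Sgrp A B ≤ Egrp A B := fun _ hf b hb a => (hf b hb a).1

/-- Right multiplication by `a` after `g`, as an endomorphism of `_B A`. -/
def mulRightEnd (g : ↥(Egrp A B)) (a : A) : ↥(Egrp A B) :=
  ⟨(AddMonoidHom.mulRight a).comp g, fun b hb x => by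
    have h := g.2 b hb x
    simp [h, mul_assoc]⟩

@[simp]
lemma mulRightEnd_apply (g : ↥(Egrp A B)) (a x : A) :
    (mulRightEnd g a : A →+ A) x = (g : A →+ A) x * a := rfl

section Quasibase

variable {n : ℕ} (γ : Fin n → ↥(Sgrp A B)) (u : Fin n → QB A B)

/-- The map `F ↦ Σ_j F(- · u_j) ⊗ γ_j`, inverse to the Galois map for a right quasibase. -/
def galoisInv : ↥(HomBQ A B) →+ (↥(Egrp A B) ⊗[ℤ] ↥(Egrp A B)) ⧸ relEE A B :=
  ∑ j, (QuotientAddGroup.mk' (relEE A B)).comp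
    ((((TensorProduct.mk ℤ _ _).flip ⟨γ j, Sgrp_le_Egrp (γ j).2⟩).toAddMonoidHom).comp
      (evalAt (u j)))

lemma galoisInv_apply (F : ↥(HomBQ A B)) :
    galoisInv γ u F = ∑ j, QuotientAddGroup.mk' (relEE A B)
      (evalAt (u j) F ⊗ₜ[ℤ] ⟨γ j, Sgrp_le_Egrp (γ j).2⟩) := by
  simp [galoisInv]

variable (hqb : ∀ a a' : A,
  mkB A B (a ⊗ₜ[ℤ] a') = ∑ j, lmulB A B (a * (γ j : A →+ A) a') (u j))
include hqb

lemma galoisMap_galoisInv (F : ↥(HomBQ A B)) : galoisMap (galoisInv γ u F) = F := by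
  refine Subtype.ext (QB_hom_ext fun a a' => ?_)
  rw [galoisInv_apply, map_sum]
  simp only [galoisMap_mk_tmul, AddSubgroup.val_finsetSum, AddMonoidHom.finsetSum_apply,
    galoisBihom_apply, mulEnd_mkB_tmul, evalAt_apply]
  rw [hqb a a', map_sum]

lemma galoisInv_galoisMap (z : (↥(Egrp A B) ⊗[ℤ] ↥(Egrp A B)) ⧸ relEE A B) :
    galoisInv γ u (galoisMap z) = z := by
  suffices h : (galoisInv γ u).comp galoisMap = AddMonoidHom.id _ from DFunLike.congr_fun h z
  refine QuotientAddGroup.addMonoidHom_ext _ (tmul_addMonoidHom_ext fun f g => ?_)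
  change galoisInv γ u (galoisBihom f g) = QuotientAddGroup.mk' (relEE A B) (f ⊗ₜ[ℤ] g)
  have hg : g = ∑ j, mulRightEnd ⟨γ j, Sgrp_le_Egrp (γ j).2⟩ (mulEnd g (u j)) := by
    ext x
    have h := congrArg (mulEnd g) (hqb 1 x)
    simpa [mulEnd_lmulB] using h
  conv_rhs => rw [hg, TensorProduct.tmul_sum, map_sum]
  rw [galoisInv_apply]
  refine Finset.sum_congr rfl fun j _ => ?_
  rw [← sub_eq_zero, ← map_sub]
  refine (QuotientAddGroup.eq_zero_iff _).2 (AddSubgroup.subset_closure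
    ⟨_, _, _, _, mulEnd g (u j), fun x => ?_, fun x => rfl, rfl⟩)
  simp [mulEnd_lmulB]

end Quasibase

variable (A B)

/-- for a depth two extension `A | B`, the map
`E ⊗_{ρ(A)} E → Hom(_B A ⊗_B A, _B A)`, `f ⊗ g ↦ (a ⊗ a' ↦ f(a g(a')))`
(the Galois map of the left `S`-extension `E | ρ(A)`) is well defined and bijective. -/
theorem statement4
    -- right D2 quasibase
    (n : ℕ) (γ : Fin n → ↥(Sgrp A B)) (u : Fin n → QB A B)
    (hu : ∀ j, ∀ b ∈ B, lmulB A B b (u j) = rmulB A B b (u j))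
    (hqb : ∀ a a' : A,
      mkB A B (a ⊗ₜ[ℤ] a') = ∑ j, lmulB A B (a * (γ j : A →+ A) a') (u j))
    -- left D2 quasibase
    (m : ℕ) (βl : Fin m → ↥(Sgrp A B)) (t : Fin m → QB A B)
    (ht : ∀ i, ∀ b ∈ B, lmulB A B b (t i) = rmulB A B b (t i))
    (hlqb : ∀ a a' : A,
      mkB A B (a ⊗ₜ[ℤ] a') = ∑ i, rmulB A B ((βl i : A →+ A) a * a') (t i)) :
    ∃ Φ : (↥(Egrp A B) ⊗[ℤ] ↥(Egrp A B)) ⧸ relEE A B →+ ↥(HomBQ A B),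
      (∀ (f g : ↥(Egrp A B)) (a a' : A),
        ((Φ ((QuotientAddGroup.mk' _) (f ⊗ₜ[ℤ] g)) : QB A B →+ A))
            (mkB A B (a ⊗ₜ[ℤ] a'))
          = (f : A →+ A) (a * (g : A →+ A) a')) ∧
      Function.Bijective Φ := by
  exact ⟨galoisMap, fun _ _ _ _ => rfl,
    Function.bijective_iff_has_inverse.2
      ⟨galoisInv γ u, galoisInv_galoisMap γ u hqb, galoisMap_galoisInv γ u hqb⟩⟩
end
end

section
/- Let k be a field and K a Hopf subalgebra of a finite-dimensional Hopf algebra H over k. Then K is a normal Hopf subalgebra of H if and only if H|K is a Hopf-Galois extension. -/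
noncomputable section

open TensorProduct

universe u v

variable (k : Type u) [Field k]

/-- The `K`-balancing relations in `H ⊗_k H`, realizing `H ⊗_K H`. -/
def relK (H : Type v) [Ring H] [Algebra k H] (K : Subalgebra k H) : Submodule k (H ⊗[k] H) :=
  Submodule.span k {z | ∃ (x y : H) (b : H), b ∈ K ∧ z = (x * b) ⊗ₜ[k] y - x ⊗ₜ[k] (b * y)}

/-- `a ↦ Σ τ(a₍₁₎) x a₍₂₎` as a map on `H ⊗ H` (to be applied to `Δa`). -/
def adL (H : Type v) [Ring H] [HopfAlgebra k H] (x : H) : H ⊗[k] H →ₗ[k] H :=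
  LinearMap.mul' k H ∘ₗ
    TensorProduct.map (LinearMap.mulRight k x ∘ₗ HopfAlgebra.antipode (R := k)) LinearMap.id

/-- `a ↦ Σ a₍₁₎ x τ(a₍₂₎)` as a map on `H ⊗ H` (to be applied to `Δa`). -/
def adR (H : Type v) [Ring H] [HopfAlgebra k H] (x : H) : H ⊗[k] H →ₗ[k] H :=
  LinearMap.mul' k H ∘ₗ
    TensorProduct.map LinearMap.id (LinearMap.mulLeft k x ∘ₗ HopfAlgebra.antipode (R := k))

/-- A witness that `H | K` is a `W`-Galois extension for some finite-dimensional Hopf algebra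
`W` over `k`: a coassociative counital algebra-homomorphism coaction `ρ : H → H ⊗ W` whose
coinvariants are exactly `K` and whose Galois map `β : H ⊗_K H → H ⊗ W`,
`x ⊗ y ↦ x y₍₀₎ ⊗ y₍₁₎`, is bijective. -/
structure GaloisExt (H : Type v) [Ring H] [Algebra k H] (K : Subalgebra k H) where
  W : Type v
  [ringW : Ring W]
  [hopfW : HopfAlgebra k W]
  [finW : FiniteDimensional k W]
  ρ : H →ₐ[k] H ⊗[k] W
  coassoc : ∀ h : H,
    (TensorProduct.assoc k H W W) ((LinearMap.rTensor W ρ.toLinearMap) (ρ h))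
      = (LinearMap.lTensor H (Coalgebra.comul (R := k))) (ρ h)
  counital : ∀ h : H,
    (TensorProduct.rid k H) ((LinearMap.lTensor H (Coalgebra.counit (R := k))) (ρ h)) = h
  coinv : ∀ h : H, ρ h = h ⊗ₜ[k] 1 ↔ h ∈ K
  β : ((H ⊗[k] H) ⧸ relK k H K) →ₗ[k] H ⊗[k] W
  hβ : ∀ x y : H, β ((relK k H K).mkQ (x ⊗ₜ[k] y)) = (x ⊗ₜ[k] (1 : W)) * ρ y
  bij : Function.Bijective β

open Coalgebra HopfAlgebra

section Comatrix

variable {k : Type*} [Field k] {ι : Type*} [Fintype ι] [DecidableEq ι]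

/-- A matrix of elements of a coalgebra with `Δ tᵢⱼ = ∑ₗ tᵢₗ ⊗ tₗⱼ` and `ε tᵢⱼ = δᵢⱼ`. -/
structure IsComatrix {C : Type*} [AddCommGroup C] [Module k C] [Coalgebra k C]
    (t : ι → ι → C) : Prop where
  comul_eq : ∀ i j, comul (R := k) (t i j) = ∑ l, t i l ⊗ₜ[k] t l j
  counit_eq : ∀ i j, counit (R := k) (t i j) = if i = j then 1 else 0

section Coalgebra

variable {C : Type*} [AddCommGroup C] [Module k C] [Coalgebra k C]

/-- The coefficients `tᵢⱼ` of the regular comodule: `Δ eᵢ = ∑ⱼ tᵢⱼ ⊗ eⱼ`. -/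
def regularComatrix (e : Module.Basis ι k C) (i j : ι) : C :=
  TensorProduct.rid k C (LinearMap.lTensor C (e.coord j) (comul (R := k) (e i)))

omit [DecidableEq ι] [Coalgebra k C] in
lemma sum_rid_lTensor_coord_tmul {M : Type*} [AddCommGroup M] [Module k M]
    (e : Module.Basis ι k C) (z : M ⊗[k] C) :
    ∑ j, TensorProduct.rid k M (LinearMap.lTensor M (e.coord j) z) ⊗ₜ[k] e j = z := by
  induction z with
  | zero => simp
  | tmul x y =>
    conv_rhs => rw [← e.sum_repr y]
    simp only [LinearMap.lTensor_tmul, TensorProduct.rid_tmul, Module.Basis.coord_apply,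
      TensorProduct.tmul_sum, TensorProduct.smul_tmul]
  | add x y hx hy =>
    conv_rhs => rw [← hx, ← hy]
    simp [TensorProduct.add_tmul, Finset.sum_add_distrib]

omit [DecidableEq ι] in
lemma comul_basis (e : Module.Basis ι k C) (i : ι) :
    comul (R := k) (e i) = ∑ j, regularComatrix e i j ⊗ₜ[k] e j :=
  (sum_rid_lTensor_coord_tmul e _).symm

omit [DecidableEq ι] in
lemma sum_counit_smul_regularComatrix (e : Module.Basis ι k C) (i : ι) :
    ∑ j, counit (R := k) (e j) • regularComatrix e i j = e i := by
  have h := congr(TensorProduct.rid k C $(lTensor_counit_comul (R := k) (e i)))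
  rw [comul_basis e i] at h
  simpa using h

lemma isComatrix_regularComatrix (e : Module.Basis ι k C) :
    IsComatrix (k := k) (regularComatrix e) where
  comul_eq i j := by
    have h := coassoc_apply (R := k) (e i)
    rw [comul_basis e i] at h
    simp only [map_sum, LinearMap.rTensor_tmul, LinearMap.lTensor_tmul, comul_basis e,
      TensorProduct.tmul_sum] at h
    let F : C ⊗[k] C →ₗ[k] C :=
      (TensorProduct.rid k C).toLinearMap ∘ₗ LinearMap.lTensor C (e.coord j)
    have hF (x : C) (l : ι) : F (x ⊗ₜ e l) = (if l = j then (1 : k) else 0) • x := by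
      simp [F, Finsupp.single_apply]
    have hG (z : C ⊗[k] C) (l : ι) : LinearMap.lTensor C F
        (TensorProduct.assoc k C C C (z ⊗ₜ[k] e l)) = (if l = j then (1 : k) else 0) • z := by
      induction z with
      | zero => simp only [TensorProduct.zero_tmul, map_zero, smul_zero]
      | tmul x y =>
        rw [TensorProduct.assoc_tmul, LinearMap.lTensor_tmul, hF, TensorProduct.tmul_smul]
      | add x y hx hy => simp only [TensorProduct.add_tmul, map_add, hx, hy, smul_add]
    have h2 := congrArg (LinearMap.lTensor C F) h
    simp only [map_sum, hG, LinearMap.lTensor_tmul, hF, ite_smul, one_smul, zero_smul,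
      TensorProduct.tmul_ite, Finset.sum_ite_eq', Finset.mem_univ,
      if_true] at h2
    exact h2
  counit_eq i j := by
    have h := congr(e.coord j (TensorProduct.lid k C $(rTensor_counit_comul (R := k) (e i))))
    rw [comul_basis e i] at h
    simpa [Finsupp.single_apply] using h

omit [DecidableEq ι] in
lemma span_regularComatrix (e : Module.Basis ι k C) :
    Submodule.span k (Set.range fun p : ι × ι ↦ regularComatrix e p.1 p.2) = ⊤ := by
  rw [eq_top_iff, ← e.span_eq, Submodule.span_le]
  rintro _ ⟨i, rfl⟩
  rw [← sum_counit_smul_regularComatrix e i]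
  exact Submodule.sum_mem _ fun j _ ↦ Submodule.smul_mem _ _ (Submodule.subset_span ⟨(i, j), rfl⟩)

lemma exists_comatrix (k C : Type*) [Field k] [AddCommGroup C] [Module k C] [Coalgebra k C]
    [FiniteDimensional k C] : ∃ (n : ℕ) (t : Fin n → Fin n → C), IsComatrix (k := k) t ∧
      Submodule.span k (Set.range fun p : Fin n × Fin n ↦ t p.1 p.2) = ⊤ :=
  ⟨_, _, isComatrix_regularComatrix (Module.finBasis k C), span_regularComatrix _⟩

end Coalgebra

lemma LinearMap.ext_of_span {M N κ : Type*} [AddCommGroup M] [Module k M] [AddCommGroup N]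
    [Module k N] {t : κ → κ → M}
    (ht : Submodule.span k (Set.range fun p : κ × κ ↦ t p.1 p.2) = ⊤) {f g : M →ₗ[k] N}
    (h : ∀ i j, f (t i j) = g (t i j)) : f = g :=
  LinearMap.ext_on_range ht fun p ↦ h p.1 p.2

lemma IsComatrix.map {C D : Type*} [AddCommGroup C] [Module k C] [Coalgebra k C]
    [AddCommGroup D] [Module k D] [Coalgebra k D] {t : ι → ι → C} (ht : IsComatrix (k := k) t)
    (f : C →ₗc[k] D) : IsComatrix (k := k) fun i j ↦ f (t i j) where
  comul_eq i j := by
    simp [← CoalgHomClass.map_comp_comul_apply, ht.comul_eq]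
  counit_eq i j := by simp [ht.counit_eq]

section Hopf

variable {A : Type*} [Ring A] [HopfAlgebra k A] {t : ι → ι → A} (ht : IsComatrix (k := k) t)

include ht

lemma IsComatrix.sum_antipode_mul (i j : ι) :
    ∑ l, antipode k (t i l) * t l j = if i = j then 1 else 0 := by
  have h := mul_antipode_rTensor_comul_apply (R := k) (t i j)
  simpa [ht.comul_eq, ht.counit_eq, apply_ite] using h

lemma IsComatrix.sum_mul_antipode (i j : ι) :
    ∑ l, t i l * antipode k (t l j) = if i = j then 1 else 0 := by
  have h := mul_antipode_lTensor_comul_apply (R := k) (t i j)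
  simpa [ht.comul_eq, ht.counit_eq, apply_ite] using h

lemma IsComatrix.sum_antipode_mul_antipode_antipode (i j : ι) :
    ∑ l, antipode k (t l j) * antipode k (antipode k (t i l)) = if i = j then 1 else 0 := by
  have h := congr(antipode k $(ht.sum_antipode_mul i j))
  simpa [antipode_mul_antidistrib, apply_ite] using h

lemma IsComatrix.sum_antipode_antipode_mul_antipode (i j : ι) :
    ∑ l, antipode k (antipode k (t l j)) * antipode k (t i l) = if i = j then 1 else 0 := by
  have h := congr(antipode k $(ht.sum_mul_antipode i j))
  simpa [antipode_mul_antidistrib, apply_ite] using h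

lemma IsComatrix.comul_antipode (i j : ι) :
    comul (R := k) (antipode k (t i j)) =
      ∑ l, antipode k (t l j) ⊗ₜ[k] antipode k (t i l) := by
  let T : Matrix ι ι (A ⊗[k] A) := Matrix.of fun i j ↦ comul (R := k) (t i j)
  let U : Matrix ι ι (A ⊗[k] A) := Matrix.of fun i j ↦ comul (R := k) (antipode k (t i j))
  let V : Matrix ι ι (A ⊗[k] A) := Matrix.of fun i j ↦ ∑ l, antipode k (t l j) ⊗ₜ[k] antipode k (t i l)
  have hUT : U * T = 1 := by
    ext i j
    have h := congr(comul (R := k) $(ht.sum_antipode_mul i j))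
    simp only [map_sum, Bialgebra.comul_mul] at h
    simp only [U, T, Matrix.mul_apply, Matrix.of_apply, h, Matrix.one_apply, apply_ite (comul (R := k)),
      Bialgebra.comul_one, map_zero]
  have hTV : T * V = 1 := by
    ext i j
    simp only [T, V, Matrix.mul_apply, Matrix.of_apply, ht.comul_eq, Finset.sum_mul_sum,
      Algebra.TensorProduct.tmul_mul_tmul]
    calc _ = ∑ m, ∑ p, (t i m * antipode k (t p j)) ⊗ₜ[k] ∑ l, t m l * antipode k (t l p) := by
          simp only [TensorProduct.tmul_sum]
          rw [Finset.sum_comm]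
          refine Finset.sum_congr rfl fun m _ ↦ Finset.sum_comm
      _ = _ := by
          simp only [ht.sum_mul_antipode, TensorProduct.tmul_ite,
            Finset.sum_ite_eq, Finset.mem_univ, if_true, ← TensorProduct.sum_tmul,
            TensorProduct.ite_tmul, Matrix.one_apply,
            Algebra.TensorProduct.one_def]
  have hUV : U = V := left_inv_eq_right_inv hUT hTV
  exact congrFun₂ hUV i j

lemma IsComatrix.antipode_swap :
    IsComatrix (k := k) fun i j ↦ antipode k (t j i) where
  comul_eq i j := ht.comul_antipode j i
  counit_eq i j := by simp [ht.counit_eq, eq_comm]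

end Hopf

end Comatrix

section Integral

variable {k : Type*} [Field k] {A : Type*} [Ring A] [HopfAlgebra k A]

/-- `x ⊗ y ↦ f(y) x`. -/
def slice (f : Module.Dual k A) : A ⊗[k] A →ₗ[k] A :=
  (TensorProduct.rid k A).toLinearMap ∘ₗ LinearMap.lTensor A f

@[simp]
lemma slice_tmul (f : Module.Dual k A) (x y : A) : slice f (x ⊗ₜ[k] y) = f y • x := by
  simp [slice]

lemma slice_mul_tmul_mul (f : Module.Dual k A) (z : A ⊗[k] A) (a b c : A) :
    slice f (z * a ⊗ₜ[k] b) * c = slice f (z * (a * c) ⊗ₜ[k] b) := by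
  induction z with
  | zero => simp
  | tmul x y => simp [mul_assoc]
  | add x y hx hy => simp only [add_mul, map_add, hx, hy]

lemma slice_comp_mulRight (f : Module.Dual k A) (z : A ⊗[k] A) (b : A) :
    slice (f ∘ₗ LinearMap.mulRight k b) z = slice f (z * 1 ⊗ₜ[k] b) := by
  induction z with
  | zero => simp
  | tmul x y => simp
  | add x y hx hy => simp only [add_mul, map_add, hx, hy]

lemma slice_coord_comul {ι : Type*} [Fintype ι] (e : Module.Basis ι k A) (j : ι) (x : A) :
    slice (e.coord j) (comul (R := k) x) = ∑ l, e.coord l x • regularComatrix e l j := by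
  conv_lhs => rw [← e.sum_repr x]
  simp only [slice, regularComatrix, map_sum, map_smul, Module.Basis.coord_apply,
    LinearMap.comp_apply, LinearEquiv.coe_coe]

/-- A functional with `x₍₁₎ φ(x₍₂₎) = φ(x) 1`. -/
def IsCointegral (φ : Module.Dual k A) : Prop :=
  ∀ x, slice φ (comul (R := k) x) = φ x • (1 : A)

variable (k A) in
lemma exists_isCointegral_ne_zero [FiniteDimensional k A] [Nontrivial A] :
    ∃ φ : Module.Dual k A, φ ≠ 0 ∧ IsCointegral φ := by
  classical
  let e := Module.finBasis k A
  let t := regularComatrix e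
  have ht : IsComatrix (k := k) t := isComatrix_regularComatrix e
  let u := fun i j ↦ antipode k (antipode k (t i j))
  have hu : IsComatrix (k := k) u := ht.antipode_swap.antipode_swap
  let φ (i) : Module.Dual k A := ∑ j, e.coord j ∘ₗ LinearMap.mulRight k (u j i)
  have hφ (i) (x) : φ i x = ∑ j, e.coord j (x * u j i) := by simp [φ]
  have hslice (i) (z : A ⊗[k] A) : slice (φ i) z = ∑ j, slice (e.coord j) (z * 1 ⊗ₜ[k] u j i) := by
    simp_rw [← slice_comp_mulRight]
    induction z with
    | zero => simp
    | tmul x y => simp [φ, Finset.sum_smul]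
    | add x y hx hy => simp only [map_add, hx, hy, Finset.sum_add_distrib]
  have hco (i) : IsCointegral (φ i) := by
    intro x
    calc slice (φ i) (comul (R := k) x)
        = ∑ j, ∑ m, slice (e.coord j)
            (comul (R := k) x * (∑ l, u l m * antipode k (t j l)) ⊗ₜ[k] u m i) := by
          simp only [u, ht.sum_antipode_antipode_mul_antipode, hslice]
          refine Finset.sum_congr rfl fun j _ ↦ ?_
          rw [Finset.sum_eq_single j]
          · simp
          · intro m _ hm
            simp [hm.symm]
          · simp
      _ = ∑ j, ∑ l, slice (e.coord j) (comul (R := k) (x * u l i)) * antipode k (t j l) := by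
          refine Finset.sum_congr rfl fun j _ ↦ ?_
          simp only [Bialgebra.comul_mul, hu.comul_eq, Finset.mul_sum, map_sum, Finset.sum_mul,
            slice_mul_tmul_mul, TensorProduct.sum_tmul]
          exact Finset.sum_comm
      _ = ∑ l, ∑ m, e.coord m (x * u l i) • ∑ j, t m j * antipode k (t j l) := by
          simp only [slice_coord_comul, Finset.sum_mul, Finset.smul_sum, smul_mul_assoc]
          rw [Finset.sum_comm]
          exact Finset.sum_congr rfl fun l _ ↦ Finset.sum_comm
      _ = φ i x • 1 := by
          simp [ht.sum_mul_antipode, hφ, Finset.sum_smul]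
  by_contra! h
  have h0 (i) (x) : φ i x = 0 := by
    by_contra hx
    exact h (φ i) (fun h' ↦ hx (by simp [h'])) (hco i)
  have hcoord (i) (x : A) : e.coord i x = 0 := by
    calc e.coord i x = ∑ l, e.coord l (x * ∑ j, antipode k (t j i) * u l j) := by
          simp [u, ht.sum_antipode_mul_antipode_antipode, apply_ite]
      _ = ∑ j, φ j (x * antipode k (t j i)) := by
          simp only [hφ, Finset.mul_sum, map_sum, mul_assoc]
          exact Finset.sum_comm
      _ = 0 := by simp [h0]
  exact one_ne_zero (α := A) (e.ext_elem fun i ↦ by simpa using hcoord i 1)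

lemma IsCointegral.eq_zero_of_forall_mul_antipode [FiniteDimensional k A] {φ : Module.Dual k A}
    (hφ : IsCointegral φ) (hφ0 : φ ≠ 0) {h : A} (hh : ∀ x, φ (x * antipode k h) = 0) : h = 0 := by
  classical
  let e := Module.finBasis k A
  let t := regularComatrix e
  have ht : IsComatrix (k := k) t := isComatrix_regularComatrix e
  have key (x : A) (i) : ∑ l, φ (x * antipode k (t i l)) • e l =
      slice φ (comul (R := k) x * 1 ⊗ₜ[k] antipode k (e i)) := by
    calc _ = ∑ l, slice φ (comul (R := k) (x * antipode k (t i l))) * e l := by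
          simp only [hφ (_ * _), smul_mul_assoc, one_mul]
      _ = ∑ m, slice φ (comul (R := k) x *
            (∑ l, antipode k (t m l) * e l) ⊗ₜ[k] antipode k (t i m)) := by
          simp only [Bialgebra.comul_mul, ht.comul_antipode, Finset.mul_sum, map_sum,
            Finset.sum_mul, slice_mul_tmul_mul, TensorProduct.sum_tmul]
          exact Finset.sum_comm
      _ = ∑ m, slice φ (comul (R := k) x *
            1 ⊗ₜ[k] antipode k (counit (R := k) (e m) • t i m)) := by
          refine Finset.sum_congr rfl fun m _ ↦ ?_
          have := mul_antipode_rTensor_comul_apply (R := k) (e m)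
          rw [comul_basis e m] at this
          simp only [map_sum, LinearMap.rTensor_tmul, LinearMap.mul'_apply] at this
          rw [this, Algebra.algebraMap_eq_smul_one, map_smul, TensorProduct.tmul_smul,
            TensorProduct.smul_tmul']
      _ = _ := by
          rw [← map_sum, ← Finset.mul_sum, ← TensorProduct.tmul_sum, ← map_sum,
            sum_counit_smul_regularComatrix]
  have hz (z : A ⊗[k] A) : slice φ (z * 1 ⊗ₜ[k] antipode k h) = 0 := by
    induction z with
    | zero => simp
    | tmul x y => simp [hh]
    | add x y hx hy => simp only [add_mul, map_add, hx, hy, add_zero]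
  have hc (x : A) (l) : ∑ i, e.repr h i * φ (x * antipode k (t i l)) = 0 := by
    have h1 : ∑ i, e.repr h i • ∑ l, φ (x * antipode k (t i l)) • e l = 0 := by
      rw [← hz (comul (R := k) x)]
      conv_rhs => rw [← e.sum_repr h]
      simp only [key, map_sum, map_smul, TensorProduct.tmul_sum, TensorProduct.tmul_smul,
        Finset.mul_sum, mul_smul_comm]
    have h2 := congr(e.repr $h1 l)
    simpa [Finsupp.single_apply] using h2
  obtain ⟨y, hy⟩ : ∃ y, φ y ≠ 0 := by
    by_contra! h'
    exact hφ0 (LinearMap.ext h')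
  refine e.ext_elem fun j ↦ ?_
  have h3 : ∑ i, e.repr h i * φ (y * ∑ l, antipode k (antipode k (t l j)) * antipode k (t i l)) =
      0 := by
    calc _ = ∑ l, ∑ i, e.repr h i * φ (y * antipode k (antipode k (t l j)) * antipode k (t i l)) := by
          simp only [Finset.mul_sum, map_sum, mul_assoc]
          exact Finset.sum_comm
      _ = 0 := by simp [hc]
  simp only [ht.sum_antipode_antipode_mul_antipode, mul_ite, mul_one, mul_zero, apply_ite φ,
    map_zero, Finset.sum_ite_eq', Finset.mem_univ, if_true] at h3
  simpa [hy] using h3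

variable (k A) in
lemma antipode_injective [FiniteDimensional k A] :
    Function.Injective (antipode k (A := A)) := by
  rcases subsingleton_or_nontrivial A with _ | _
  · exact Function.injective_of_subsingleton _
  obtain ⟨φ, hφ0, hφ⟩ := exists_isCointegral_ne_zero k A
  rw [injective_iff_map_eq_zero]
  exact fun h hh ↦ hφ.eq_zero_of_forall_mul_antipode hφ0 (by simp [hh])

variable (k A) in
lemma exists_integral_cointegral [FiniteDimensional k A] [Nontrivial A] :
    ∃ (φ : Module.Dual k A) (Λ : A), IsCointegral φ ∧ φ Λ = 1 ∧
      ∀ b, Λ * b = counit (R := k) b • Λ := by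
  obtain ⟨φ, hφ0, hφ⟩ := exists_isCointegral_ne_zero k A
  let B : A →ₗ[k] A →ₗ[k] k :=
    ((LinearMap.mul k A).compr₂ φ).compl₂ (antipode k)
  have hB (x h : A) : B x h = φ (x * antipode k h) := rfl
  have hinj : Function.Injective B.flip := by
    rw [injective_iff_map_eq_zero]
    exact fun h hh ↦ hφ.eq_zero_of_forall_mul_antipode hφ0 fun x ↦ congr($hh x)
  have hsurj : Function.Surjective B := LinearMap.flip_injective_iff₁.1 hinj
  have hinj' : Function.Injective B :=
    (LinearMap.injective_iff_surjective_of_finrank_eq_finrank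
      (Subspace.dual_finrank_eq (K := k) (V := A)).symm).2 hsurj
  obtain ⟨Λ, hΛ⟩ := hsurj (counit (R := k))
  refine ⟨φ, Λ, hφ, ?_, fun b ↦ ?_⟩
  · have := hB Λ 1
    simpa [hΛ] using this.symm
  · obtain ⟨b, rfl⟩ := (LinearMap.injective_iff_surjective.1 (antipode_injective k A)) b
    refine hinj' (LinearMap.ext fun h ↦ ?_)
    rw [hB, mul_assoc, ← antipode_mul_antidistrib, ← hB, hΛ]
    simp [hΛ, mul_comm]

/-- A finite-dimensional Hopf algebra is self-injective, so it splits off as a module from any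
Hopf algebra containing it. -/
lemma exists_retraction [FiniteDimensional k A] {H : Type*} [Ring H] [HopfAlgebra k H]
    (j : A →ₐc[k] H) (hj : Function.Injective j) :
    ∃ p : H →ₗ[k] A, p 1 = 1 ∧ ∀ a h, p (j a * h) = a * p h := by
  rcases subsingleton_or_nontrivial A with _ | _
  · exact ⟨0, Subsingleton.elim _ _, fun _ _ ↦ Subsingleton.elim _ _⟩
  obtain ⟨φ, Λ, hφ, hφΛ, hΛ⟩ := exists_integral_cointegral k A
  obtain ⟨r, hr⟩ := LinearMap.exists_leftInverse_of_injective (j : A →ₗ[k] H)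
    (LinearMap.ker_eq_bot.2 hj)
  have hrj (a : A) : r (j a) = a := congr($hr a)
  let f : H →ₗ[k] k := φ ∘ₗ r
  have hf (a : A) : f (j a) = φ a := congrArg φ (hrj a)
  let G : A ⊗[k] A →ₗ[k] H →ₗ[k] A := TensorProduct.lift
    (LinearMap.mk₂ k (fun x y ↦ (LinearMap.toSpanSingleton k A (antipode k x)) ∘ₗ f ∘ₗ
      LinearMap.mulLeft k (j y)) (fun x x' y ↦ by ext; simp) (fun c x y ↦ by ext; simp [smul_comm c])
      (fun x y y' ↦ by ext; simp [add_mul, add_smul]) (fun c x y ↦ by ext; simp [mul_smul]))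
  have hG (x y : A) (h : H) : G (x ⊗ₜ y) h = f (j y * h) • antipode k x := by simp [G]
  have hGmul (z : A ⊗[k] A) (a b : A) (h : H) :
      G (z * a ⊗ₜ b) h = antipode k a * G z (j b * h) := by
    induction z with
    | zero => simp
    | tmul x y => simp [hG, antipode_mul_antidistrib, mul_assoc]
    | add x y hx hy => simp only [add_mul, map_add, LinearMap.add_apply, hx, hy, mul_add]
  have hG1 (z : A ⊗[k] A) : G z 1 = antipode k (slice φ z) := by
    induction z with
    | zero => simp
    | tmul x y => simp [hG, hf]
    | add x y hx hy => simp only [map_add, LinearMap.add_apply, hx, hy]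
  refine ⟨G (comul (R := k) Λ), ?_, fun a h ↦ ?_⟩
  · rw [hG1, hφ, hφΛ, one_smul, antipode_one]
  · obtain ⟨n, t, ht, hspan⟩ := exists_comatrix k A
    have h1 (i m) : ∑ l, antipode k (t i l) * G (comul (R := k) Λ) (j (t l m) * h) =
        if i = m then G (comul (R := k) Λ) h else 0 := by
      have := congr(G (comul (R := k) $(hΛ (t i m))) h)
      rw [Bialgebra.comul_mul, ht.comul_eq, ht.counit_eq] at this
      simp only [Finset.mul_sum, map_sum, LinearMap.sum_apply, hGmul] at this
      rw [this]
      split_ifs <;> simp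
    suffices h2 : (G (comul (R := k) Λ)) ∘ₗ LinearMap.mulRight k h ∘ₗ (j : A →ₗ[k] H) =
        LinearMap.mulRight k (G (comul (R := k) Λ) h) from congr($h2 a)
    refine LinearMap.ext_of_span hspan fun i m ↦ ?_
    calc G (comul (R := k) Λ) (j (t i m) * h)
        = ∑ l, (∑ q, t i q * antipode k (t q l)) * G (comul (R := k) Λ) (j (t l m) * h) := by
          simp [ht.sum_mul_antipode]
      _ = ∑ q, t i q * ∑ l, antipode k (t q l) * G (comul (R := k) Λ) (j (t l m) * h) := by
          simp only [Finset.sum_mul, Finset.mul_sum, mul_assoc]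
          exact Finset.sum_comm
      _ = t i m * G (comul (R := k) Λ) h := by simp [h1]

end Integral

section HopfSubalgebra

variable {k} {H : Type v} [Ring H] [HopfAlgebra k H]

lemma map_val_injective (K : Subalgebra k H) :
    Function.Injective (Algebra.TensorProduct.map K.val K.val) :=
  TensorProduct.map_injective_of_flat_flat K.val.toLinearMap K.val.toLinearMap
    Subtype.val_injective Subtype.val_injective

lemma map_map_val_injective (K : Subalgebra k H) : Function.Injective
    (Algebra.TensorProduct.map K.val (Algebra.TensorProduct.map K.val K.val)) :=
  TensorProduct.map_injective_of_flat_flat K.val.toLinearMap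
    (TensorProduct.map K.val.toLinearMap K.val.toLinearMap)
    Subtype.val_injective (map_val_injective K)

/-- The comultiplication restricted to a subalgebra `K` with `Δ(K) ⊆ K ⊗ K`. -/
def subalgebraComul (K : Subalgebra k H) (hΔ : ∀ x ∈ K, comul (R := k) x ∈
    LinearMap.range (TensorProduct.map K.val.toLinearMap K.val.toLinearMap)) :
    K →ₐ[k] K ⊗[k] K :=
  (AlgEquiv.ofInjective _ (map_val_injective K)).symm.toAlgHom.comp
    (((Bialgebra.comulAlgHom k H).comp K.val).codRestrict
      (Algebra.TensorProduct.map K.val K.val).range fun x ↦ hΔ x x.2)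

lemma map_val_subalgebraComul (K : Subalgebra k H) (hΔ : ∀ x ∈ K, comul (R := k) x ∈
    LinearMap.range (TensorProduct.map K.val.toLinearMap K.val.toLinearMap)) (x : K) :
    Algebra.TensorProduct.map K.val K.val (subalgebraComul K hΔ x) = comul (R := k) (x : H) :=
  congrArg Subtype.val
    (AlgEquiv.apply_symm_apply (AlgEquiv.ofInjective _ (map_val_injective K)) _)

/-- The antipode restricted to a subalgebra stable under it. -/
def subalgebraAntipode (K : Subalgebra k H) (hS : ∀ x ∈ K, antipode k x ∈ K) : K →ₗ[k] K :=
  (antipode k).restrict (p := K.toSubmodule) (q := K.toSubmodule) hS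

lemma coe_subalgebraAntipode (K : Subalgebra k H) (hS : ∀ x ∈ K, antipode k x ∈ K) (x : K) :
    (subalgebraAntipode K hS x : H) = antipode k (x : H) := rfl

/-- A Hopf subalgebra as a Hopf algebra in its own right. -/
@[reducible]
def subalgebraHopf (K : Subalgebra k H) (hΔ : ∀ x ∈ K, comul (R := k) x ∈
    LinearMap.range (TensorProduct.map K.val.toLinearMap K.val.toLinearMap))
    (hS : ∀ x ∈ K, antipode k x ∈ K) : HopfAlgebra k K :=
  letI : Bialgebra k K := .ofAlgHom (subalgebraComul K hΔ)
    ((Bialgebra.counitAlgHom k H).comp K.val)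
    (by
      refine AlgHom.ext fun x ↦ map_map_val_injective K ?_
      have h1 (z : K ⊗[k] K) : Algebra.TensorProduct.map K.val (Algebra.TensorProduct.map K.val K.val)
          (Algebra.TensorProduct.assoc k k k K K K
            (Algebra.TensorProduct.map (subalgebraComul K hΔ) (.id k K) z)) =
          TensorProduct.assoc k H H H (LinearMap.rTensor H (comul (R := k))
            (Algebra.TensorProduct.map K.val K.val z)) := by
        induction z with
        | zero => simp
        | tmul x y =>
          simp only [Algebra.TensorProduct.map_tmul, AlgHom.id_apply, LinearMap.rTensor_tmul,
            Subalgebra.coe_val, ← map_val_subalgebraComul K hΔ]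
          induction subalgebraComul K hΔ x with
          | zero => simp
          | tmul x y => simp
          | add x y hx hy => simp only [TensorProduct.add_tmul, map_add, hx, hy]
        | add x y hx hy => simp only [map_add, hx, hy]
      have h2 (z : K ⊗[k] K) : Algebra.TensorProduct.map K.val (Algebra.TensorProduct.map K.val K.val)
            (Algebra.TensorProduct.map (.id k K) (subalgebraComul K hΔ) z) =
          LinearMap.lTensor H (comul (R := k))
            (Algebra.TensorProduct.map K.val K.val z) := by
        induction z with
        | zero => simp
        | tmul x y => simp [map_val_subalgebraComul K hΔ]
        | add x y hx hy => simp only [map_add, hx, hy]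
      refine (h1 (subalgebraComul K hΔ x)).trans (Eq.trans ?_ (h2 (subalgebraComul K hΔ x)).symm)
      rw [map_val_subalgebraComul, coassoc_apply])
    (by
      refine AlgHom.ext fun x ↦ ?_
      have h1 (z : K ⊗[k] K) : (TensorProduct.lid k H) (LinearMap.rTensor H (counit (R := k))
            (Algebra.TensorProduct.map K.val K.val z)) =
          Algebra.TensorProduct.lid k K (Algebra.TensorProduct.map
            ((Bialgebra.counitAlgHom k H).comp K.val) (.id k K) z) := by
        induction z with
        | zero => simp
        | tmul x y => simp
        | add x y hx hy => simp only [map_add, hx, hy, Subalgebra.coe_add]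
      refine (Algebra.TensorProduct.lid k K).injective (Subtype.ext ((h1 (subalgebraComul K hΔ x)).symm.trans ?_))
      rw [map_val_subalgebraComul, rTensor_counit_comul]
      simp)
    (by
      refine AlgHom.ext fun x ↦ ?_
      have h1 (z : K ⊗[k] K) : (TensorProduct.rid k H) (LinearMap.lTensor H (counit (R := k))
            (Algebra.TensorProduct.map K.val K.val z)) =
          Algebra.TensorProduct.rid k k K (Algebra.TensorProduct.map (.id k K)
            ((Bialgebra.counitAlgHom k H).comp K.val) z) := by
        induction z with
        | zero => simp
        | tmul x y => simp
        | add x y hx hy => simp only [map_add, hx, hy, Subalgebra.coe_add]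
      refine (Algebra.TensorProduct.rid k k K).injective (Subtype.ext ((h1 (subalgebraComul K hΔ x)).symm.trans ?_))
      rw [map_val_subalgebraComul, lTensor_counit_comul]
      simp)
  { antipode := subalgebraAntipode K hS
    mul_antipode_rTensor_comul := by
      refine LinearMap.ext fun x ↦ Subtype.ext ?_
      have h1 (z : K ⊗[k] K) : (LinearMap.mul' k K ((subalgebraAntipode K hS).rTensor K z) : H) =
          LinearMap.mul' k H ((antipode k).rTensor H (Algebra.TensorProduct.map K.val K.val z)) := by
        induction z with
        | zero => simp
        | tmul x y => simp [coe_subalgebraAntipode]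
        | add x y hx hy => simp only [map_add, hx, hy, Subalgebra.coe_add]
      refine (h1 _).trans ?_
      change LinearMap.mul' k H ((antipode k).rTensor H (Algebra.TensorProduct.map K.val K.val
        (subalgebraComul K hΔ x))) = _
      rw [map_val_subalgebraComul, mul_antipode_rTensor_comul_apply]
      rfl
    mul_antipode_lTensor_comul := by
      refine LinearMap.ext fun x ↦ Subtype.ext ?_
      have h1 (z : K ⊗[k] K) : (LinearMap.mul' k K ((subalgebraAntipode K hS).lTensor K z) : H) =
          LinearMap.mul' k H ((antipode k).lTensor H (Algebra.TensorProduct.map K.val K.val z)) := by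
        induction z with
        | zero => simp
        | tmul x y => simp [coe_subalgebraAntipode]
        | add x y hx hy => simp only [map_add, hx, hy, Subalgebra.coe_add]
      refine (h1 _).trans ?_
      change LinearMap.mul' k H ((antipode k).lTensor H (Algebra.TensorProduct.map K.val K.val
        (subalgebraComul K hΔ x))) = _
      rw [map_val_subalgebraComul, mul_antipode_lTensor_comul_apply]
      rfl }

variable [FiniteDimensional k H] (K : Subalgebra k H) (hΔ : ∀ x ∈ K, comul (R := k) x ∈
    LinearMap.range (TensorProduct.map K.val.toLinearMap K.val.toLinearMap))
  (hS : ∀ x ∈ K, antipode k x ∈ K)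

include hΔ hS

lemma exists_subalgebra_comatrix : ∃ (n : ℕ) (t : Fin n → Fin n → H), IsComatrix (k := k) t ∧
    Submodule.span k (Set.range fun p : Fin n × Fin n ↦ t p.1 p.2) = K.toSubmodule := by
  let := subalgebraHopf K hΔ hS
  obtain ⟨n, t, ht, hspan⟩ := exists_comatrix k K
  let j : K →ₗc[k] H :=
    { K.val.toLinearMap with
      counit_comp := rfl
      map_comp_comul := LinearMap.ext fun x ↦ map_val_subalgebraComul K hΔ x }
  refine ⟨n, fun a b ↦ (t a b : H), ht.map j, ?_⟩
  have h := congrArg (Submodule.map K.val.toLinearMap) hspan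
  rw [Submodule.map_span, ← Set.range_comp] at h
  refine h.trans ?_
  ext x
  simp

lemma exists_subalgebra_retraction : ∃ p : H →ₗ[k] H, (∀ h, p h ∈ K) ∧ p 1 = 1 ∧
    ∀ b ∈ K, ∀ h, p (b * h) = b * p h := by
  let := subalgebraHopf K hΔ hS
  let j : K →ₐc[k] H := .ofAlgHom K.val rfl
    (AlgHom.ext fun x ↦ map_val_subalgebraComul K hΔ x)
  obtain ⟨p, hp1, hp⟩ := exists_retraction j Subtype.val_injective
  refine ⟨K.val.toLinearMap ∘ₗ p, fun h ↦ (p h).2, by simp [hp1], fun b hb h ↦ ?_⟩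
  exact congrArg Subtype.val (hp ⟨b, hb⟩ h)

end HopfSubalgebra

section Retraction

variable {k} {H : Type v} [Ring H] [HopfAlgebra k H]

/-- `y ↦ τ(y₍₁₎) p(y₍₂₎)`. -/
def antipodeConv (p : H →ₗ[k] H) : H →ₗ[k] H :=
  LinearMap.mul' k H ∘ₗ TensorProduct.map (antipode k) p ∘ₗ comul (R := k)

lemma antipodeConv_one {p : H →ₗ[k] H} (hp1 : p 1 = 1) : antipodeConv p 1 = 1 := by
  simp [antipodeConv, Algebra.TensorProduct.one_def, hp1]

lemma IsComatrix.antipodeConv_eq {ι : Type*} [Fintype ι] [DecidableEq ι] {s : ι → ι → H}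
    (hs : IsComatrix (k := k) s) (p : H →ₗ[k] H) (i j : ι) :
    antipodeConv p (s i j) = ∑ l, antipode k (s i l) * p (s l j) := by
  simp [antipodeConv, hs.comul_eq]

/-- The right ideal `K⁺H`. -/
def augRight (K : Subalgebra k H) : Submodule k H :=
  Submodule.span k {z | ∃ b ∈ K, counit (R := k) b = 0 ∧ ∃ y, z = b * y}

lemma mul_mem_augRight {K : Subalgebra k H} {b : H} (hb : b ∈ K) (hb0 : counit (R := k) b = 0)
    (y : H) : b * y ∈ augRight K :=
  Submodule.subset_span ⟨b, hb, hb0, y, rfl⟩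

lemma augRight_mul_mem {K : Subalgebra k H} {z : H} (hz : z ∈ augRight K) (v : H) :
    z * v ∈ augRight K := by
  induction hz using Submodule.span_induction with
  | mem z hz =>
    obtain ⟨b, hb, hb0, y, rfl⟩ := hz
    rw [mul_assoc]
    exact mul_mem_augRight hb hb0 _
  | zero => simp
  | add x y _ _ hx hy => rw [add_mul]; exact add_mem hx hy
  | smul c x _ hx => rw [smul_mul_assoc]; exact Submodule.smul_mem _ _ hx

lemma sub_counit_mem {K : Subalgebra k H} {b : H} (hb : b ∈ K) :
    b - counit (R := k) b • (1 : H) ∈ K :=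
  sub_mem hb (K.smul_mem (one_mem K) _)

lemma counit_sub_counit (b : H) :
    counit (R := k) (b - counit (R := k) b • (1 : H)) = 0 := by
  simp

variable {K : Subalgebra k H} {n : ℕ} {t : Fin n → Fin n → H} (ht : IsComatrix (k := k) t)
  (hspan : Submodule.span k (Set.range fun p : Fin n × Fin n ↦ t p.1 p.2) = K.toSubmodule)
  {p : H →ₗ[k] H} (hpm : ∀ b ∈ K, ∀ h, p (b * h) = b * p h)

include hspan

lemma comatrix_mem (i j : Fin n) : t i j ∈ K := by
  have : t i j ∈ K.toSubmodule := hspan ▸ Submodule.subset_span ⟨(i, j), rfl⟩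
  exact this

lemma LinearMap.eq_of_comatrix {M : Type*} [AddCommGroup M] [Module k M] {f g : H →ₗ[k] M}
    (h : ∀ i j, f (t i j) = g (t i j)) {b : H} (hb : b ∈ K) : f b = g b := by
  have hb' : b ∈ Submodule.span k (Set.range fun p : Fin n × Fin n ↦ t p.1 p.2) := hspan ▸ hb
  refine LinearMap.eqOn_span ?_ hb'
  rintro _ ⟨p, rfl⟩
  exact h p.1 p.2

include ht hpm

lemma antipodeConv_mul {b : H} (hb : b ∈ K) (y : H) :
    antipodeConv p (b * y) = counit (R := k) b • antipodeConv p y := by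
  suffices h : ∀ i j, (antipodeConv p ∘ₗ LinearMap.mulRight k y) (t i j) =
      LinearMap.toSpanSingleton k H (antipodeConv p y) ((counit (R := k)) (t i j)) from
    LinearMap.eq_of_comatrix (f := antipodeConv p ∘ₗ LinearMap.mulRight k y)
      (g := LinearMap.toSpanSingleton k H (antipodeConv p y) ∘ₗ counit) hspan h hb
  intro i j
  have hz (z : H ⊗[k] H) : ∑ l, LinearMap.mul' k H (TensorProduct.map (antipode k) p
      (t i l ⊗ₜ[k] t l j * z)) = (if i = j then (1 : k) else 0) •
        LinearMap.mul' k H (TensorProduct.map (antipode k) p z) := by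
    induction z with
    | zero => simp
    | tmul u v =>
      calc _ = antipode k u * (∑ l, antipode k (t i l) * t l j) * p v := by
            simp [antipode_mul_antidistrib, hpm _ (comatrix_mem hspan _ _), Finset.mul_sum,
              Finset.sum_mul, mul_assoc]
        _ = _ := by
            rw [ht.sum_antipode_mul]
            split_ifs <;> simp
    | add x y hx hy => simp only [mul_add, map_add, smul_add, Finset.sum_add_distrib, hx, hy]
  simpa [antipodeConv, Bialgebra.comul_mul, ht.comul_eq, ht.counit_eq, Finset.sum_mul] using
    hz (comul (R := k) y)

lemma antipodeConv_eq_zero {z : H} (hz : z ∈ augRight K) : antipodeConv p z = 0 := by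
  have : augRight K ≤ LinearMap.ker (antipodeConv p) := by
    refine Submodule.span_le.2 ?_
    rintro _ ⟨b, hb, hb0, y, rfl⟩
    simp [antipodeConv_mul ht hspan hpm hb, hb0]
  exact this hz

omit ht hspan hpm in
lemma mul_antipodeConv_comul [FiniteDimensional k H] (p : H →ₗ[k] H) (h : H) :
    LinearMap.mul' k H (LinearMap.lTensor H (antipodeConv p) (comul (R := k) h)) = p h := by
  obtain ⟨m, s, hs, hsspan⟩ := exists_comatrix k H
  suffices h1 : LinearMap.mul' k H ∘ₗ LinearMap.lTensor H (antipodeConv p) ∘ₗ comul = p from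
    congr($h1 h)
  refine LinearMap.ext_of_span hsspan fun i j ↦ ?_
  calc _ = ∑ q, (∑ l, s i l * antipode k (s l q)) * p (s q j) := by
        simp only [LinearMap.comp_apply, hs.comul_eq, map_sum, LinearMap.lTensor_tmul,
          LinearMap.mul'_apply, hs.antipodeConv_eq, Finset.mul_sum, Finset.sum_mul, mul_assoc]
        exact Finset.sum_comm
    _ = p (s i j) := by simp [hs.sum_mul_antipode]

lemma adR_mem [FiniteDimensional k H] (hpK : ∀ h, p h ∈ K) (hp1 : p 1 = 1)
    (hJ : ∀ y, ∀ b ∈ K, counit (R := k) b = 0 → y * b ∈ augRight K) {x : H} (hx : x ∈ K) (a : H) :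
    adR k H x (comul (R := k) a) ∈ K := by
  obtain ⟨m, s, hs, hsspan⟩ := exists_comatrix k H
  have hθ (u b v : H) (hb : b ∈ K) : antipodeConv p (u * b * v) =
      counit (R := k) b • antipodeConv p (u * v) := by
    have h0 := antipodeConv_eq_zero ht hspan hpm
      (augRight_mul_mem (hJ u _ (sub_counit_mem hb) (counit_sub_counit b)) v)
    simpa [mul_sub, sub_mul, sub_eq_zero] using h0
  have hadR (x : H) (i j) : adR k H x (comul (R := k) (s i j)) =
      ∑ q, s i q * x * antipode k (s q j) := by
    simp [adR, hs.comul_eq, mul_assoc]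
  suffices h : p (adR k H x (comul (R := k) a)) = adR k H x (comul (R := k) a) from
    h ▸ hpK _
  suffices h : p ∘ₗ adR k H x ∘ₗ comul = adR k H x ∘ₗ comul from congr($h a)
  refine LinearMap.ext_of_span hsspan fun i j ↦ ?_
  let A : H →ₗ[k] H := ∑ q, LinearMap.mulRight k (antipode k (s q j)) ∘ₗ LinearMap.mulLeft k (s i q)
  suffices h : p (A x) = A x by simpa [hadR, A] using h
  refine LinearMap.eq_of_comatrix (f := p ∘ₗ A) hspan (fun l r ↦ ?_) hx
  calc p (A (t l r))
      = ∑ q, ∑ c, ∑ b, ∑ a, s i a * t l b * antipode k (s c j) *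
          antipodeConv p (s a q * t b r * antipode k (s q c)) := by
        rw [← mul_antipodeConv_comul]
        simp only [A, LinearMap.sum_apply, LinearMap.comp_apply, LinearMap.mulRight_apply,
          LinearMap.mulLeft_apply, map_sum, Bialgebra.comul_mul, hs.comul_eq, ht.comul_eq,
          hs.comul_antipode, Finset.sum_mul, Finset.mul_sum,
          Algebra.TensorProduct.tmul_mul_tmul, LinearMap.lTensor_tmul, LinearMap.mul'_apply]
    _ = ∑ q, ∑ c, ∑ a, s i a * t l r * antipode k (s c j) *
          antipodeConv p (s a q * antipode k (s q c)) := by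
        simp only [hθ _ _ _ (comatrix_mem hspan _ _), ht.counit_eq, ite_smul,
          one_smul, zero_smul]
        refine Finset.sum_congr rfl fun q _ ↦ Finset.sum_congr rfl fun c _ ↦ ?_
        rw [Finset.sum_comm]
        simp
    _ = ∑ c, ∑ a, s i a * t l r * antipode k (s c j) *
          antipodeConv p (∑ q, s a q * antipode k (s q c)) := by
        simp only [map_sum, Finset.mul_sum]
        rw [Finset.sum_comm]
        exact Finset.sum_congr rfl fun c _ ↦ Finset.sum_comm
    _ = A (t l r) := by
        simp [A, hs.sum_mul_antipode, apply_ite, antipodeConv_one hp1]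

end Retraction

section

variable {k} {H : Type v} [Ring H] [HopfAlgebra k H] [FiniteDimensional k H] {K : Subalgebra k H}

lemma mem_of_antipode_mem (hS : ∀ x ∈ K, antipode k x ∈ K) {x : H} (hx : antipode k x ∈ K) :
    x ∈ K := by
  have hinj : Function.Injective (subalgebraAntipode K hS) := fun a b h ↦
    Subtype.ext (antipode_injective k H congr(($h : H)))
  obtain ⟨y, hy⟩ := LinearMap.injective_iff_surjective.1 hinj ⟨_, hx⟩
  rw [antipode_injective k H (congr(($hy : H)) : antipode k (y : H) = antipode k x).symm]
  exact y.2

lemma adL_mem_of_adR_mem (hS : ∀ x ∈ K, antipode k x ∈ K)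
    (h : ∀ x ∈ K, ∀ a, adR k H x (comul (R := k) a) ∈ K) {x : H} (hx : x ∈ K) (a : H) :
    adL k H x (comul (R := k) a) ∈ K := by
  refine mem_of_antipode_mem hS ?_
  suffices h1 : antipode k ∘ₗ adL k H x ∘ₗ comul = adR k H (antipode k x) ∘ₗ comul ∘ₗ antipode k from
    (congr($h1 a) : antipode k (adL k H x (comul (R := k) a)) = _) ▸ h _ (hS x hx) _
  obtain ⟨m, s, hs, hsspan⟩ := exists_comatrix k H
  refine LinearMap.ext_of_span hsspan fun i j ↦ ?_
  simp [adL, adR, hs.comul_eq, hs.comul_antipode, antipode_mul_antidistrib]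

lemma normal_of_mul_mem_augRight
    (hΔ : ∀ x ∈ K, comul (R := k) x ∈
      LinearMap.range (TensorProduct.map K.val.toLinearMap K.val.toLinearMap))
    (hS : ∀ x ∈ K, antipode k x ∈ K)
    (hJ : ∀ y, ∀ b ∈ K, counit (R := k) b = 0 → y * b ∈ augRight K) :
    ∀ x ∈ K, ∀ a : H, adL k H x (comul (R := k) a) ∈ K ∧ adR k H x (comul (R := k) a) ∈ K := by
  obtain ⟨n, t, ht, hspan⟩ := exists_subalgebra_comatrix K hΔ hS
  obtain ⟨p, hpK, hp1, hpm⟩ := exists_subalgebra_retraction K hΔ hS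
  have hR : ∀ x ∈ K, ∀ a, adR k H x (comul (R := k) a) ∈ K :=
    fun x hx a ↦ adR_mem ht hspan hpm hpK hp1 hJ hx a
  exact fun x hx a ↦ ⟨adL_mem_of_adR_mem hS hR hx a, hR x hx a⟩

end

section

variable {k} {H : Type v} [Ring H] [HopfAlgebra k H] {K : Subalgebra k H}

/-- `x ⊗ y ↦ ε(x) y` from `H ⊗_K H` to `H / K⁺H`. -/
def counitQuot (K : Subalgebra k H) : ((H ⊗[k] H) ⧸ relK k H K) →ₗ[k] H ⧸ augRight K :=
  (relK k H K).liftQ ((augRight K).mkQ ∘ₗ (TensorProduct.lid k H).toLinearMap ∘ₗ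
    LinearMap.rTensor H (counit (R := k))) <| by
    refine Submodule.span_le.2 ?_
    rintro _ ⟨x, y, b, hb, rfl⟩
    have h := Submodule.smul_mem _ (-counit (R := k) x)
      (mul_mem_augRight (sub_counit_mem hb) (counit_sub_counit b) y)
    simp only [SetLike.mem_coe, LinearMap.mem_ker, LinearMap.comp_apply, Submodule.mkQ_apply,
      Submodule.Quotient.mk_eq_zero]
    convert h using 1
    simp [sub_mul, smul_sub, mul_smul, ← sub_eq_neg_add]

lemma counitQuot_mkQ_tmul (x y : H) : counitQuot K ((relK k H K).mkQ (x ⊗ₜ[k] y)) =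
    counit (R := k) x • (augRight K).mkQ y :=
  (Submodule.liftQ_apply _ _ _).trans (by simp)

lemma GaloisExt.mul_mem_augRight (G : GaloisExt k H K) (y : H) {b : H} (hb : b ∈ K)
    (hb0 : counit (R := k) b = 0) : y * b ∈ augRight K := by
  let := G.ringW
  let := G.hopfW
  let ω : H ⊗[k] G.W →ₗ[k] H ⧸ augRight K :=
    counitQuot K ∘ₗ (LinearEquiv.ofBijective G.β G.bij).symm
  have hω (m) : ω (G.β m) = counitQuot K m :=
    congrArg (counitQuot K) (LinearEquiv.symm_apply_apply (LinearEquiv.ofBijective G.β G.bij) m)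
  have hω_mul (a : H) (z) : ω (a ⊗ₜ[k] 1 * z) = counit (R := k) a • ω z := by
    obtain ⟨m, rfl⟩ := G.bij.2 z
    obtain ⟨s, rfl⟩ := (relK k H K).mkQ_surjective m
    induction s with
    | zero => simp
    | tmul x y =>
      have h : a ⊗ₜ[k] (1 : G.W) * G.β ((relK k H K).mkQ (x ⊗ₜ[k] y)) =
          G.β ((relK k H K).mkQ ((a * x) ⊗ₜ[k] y)) := by
        rw [G.hβ, G.hβ, ← mul_assoc, Algebra.TensorProduct.tmul_mul_tmul, mul_one]
      rw [h, hω, hω, counitQuot_mkQ_tmul, counitQuot_mkQ_tmul, Bialgebra.counit_mul, mul_smul]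
    | add x y hx hy => simp only [map_add, mul_add, smul_add, hx, hy]
  have hω_right (z : H ⊗[k] G.W) : ω (z * b ⊗ₜ[k] 1) = 0 := by
    induction z with
    | zero => simp
    | tmul h w =>
      rw [Algebra.TensorProduct.tmul_mul_tmul, mul_one, ← mul_one (h * b), ← one_mul w,
        ← Algebra.TensorProduct.tmul_mul_tmul, hω_mul]
      simp [hb0]
    | add x y hx hy => simp only [map_add, add_mul, hx, hy, add_zero]
  rw [← Submodule.Quotient.mk_eq_zero, ← Submodule.mkQ_apply]
  calc (augRight K).mkQ (y * b) = ω (G.ρ (y * b)) := by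
        rw [← one_mul (G.ρ (y * b)), Algebra.TensorProduct.one_def, ← G.hβ, hω,
          counitQuot_mkQ_tmul]
        simp
    _ = 0 := by rw [map_mul, (G.coinv b).2 hb, hω_right]

end

section

variable {k} {H : Type v} [Ring H] [HopfAlgebra k H] {K : Subalgebra k H}

/-- The left ideal `HK⁺`. -/
def augIdeal (K : Subalgebra k H) : Ideal H :=
  Ideal.span {b | b ∈ K ∧ counit (R := k) b = 0}

lemma mem_augIdeal {b : H} (hb : b ∈ K) (hb0 : counit (R := k) b = 0) : b ∈ augIdeal K :=
  Ideal.subset_span ⟨hb, hb0⟩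

lemma mk_augIdeal_eq [(augIdeal K).IsTwoSided] {b : H} (hb : b ∈ K) :
    Ideal.Quotient.mk (augIdeal K) b = counit (R := k) b • 1 := by
  have h := Ideal.Quotient.eq_zero_iff_mem.2
    (mem_augIdeal (sub_counit_mem hb) (counit_sub_counit b))
  rw [map_sub, sub_eq_zero] at h
  exact h.trans ((map_smul (Ideal.Quotient.mkₐ k (augIdeal K)) _ _).trans (by simp))

lemma mem_of_forall_comatrix_mem {ι M : Type*} [AddCommGroup M] [Module k M] {s : ι → ι → H}
    (hs : Submodule.span k (Set.range fun p : ι × ι ↦ s p.1 p.2) = ⊤) (N : Submodule k M)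
    {f : H →ₗ[k] M} (h : ∀ i j, f (s i j) ∈ N) (x : H) : f x ∈ N := by
  rw [← Submodule.Quotient.mk_eq_zero]
  have h1 : N.mkQ ∘ₗ f = 0 := LinearMap.ext_of_span hs fun i j ↦ by
    simpa using h i j
  exact congr($h1 x)

section Normal

variable [FiniteDimensional k H]
  (hN : ∀ x ∈ K, ∀ a : H,
    adL k H x (comul (R := k) a) ∈ K ∧ adR k H x (comul (R := k) a) ∈ K)

include hN

lemma mul_mem_augRight_of_normal (y : H) {b : H} (hb : b ∈ K) (hb0 : counit (R := k) b = 0) :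
    y * b ∈ augRight K := by
  obtain ⟨m, s, hs, hsspan⟩ := exists_comatrix k H
  refine mem_of_forall_comatrix_mem hsspan (augRight K) (f := LinearMap.mulRight k b)
    (fun i j ↦ ?_) y
  have h : s i j * b = ∑ l, adR k H b (comul (R := k) (s i l)) * s l j := by
    calc s i j * b = ∑ q, s i q * b * ∑ l, antipode k (s q l) * s l j := by
          simp [hs.sum_antipode_mul]
      _ = _ := by
          simp only [adR, hs.comul_eq, map_sum, LinearMap.comp_apply, TensorProduct.map_tmul,
            LinearMap.id_apply, LinearMap.mulLeft_apply, LinearMap.mul'_apply, Finset.sum_mul,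
            Finset.mul_sum, mul_assoc]
          exact Finset.sum_comm
  rw [LinearMap.mulRight_apply, h]
  refine sum_mem fun l _ ↦ mul_mem_augRight (hN b hb _).2 ?_ _
  simp [adR, hs.comul_eq, hb0]

lemma mul_mem_augIdeal_of_normal (y : H) {b : H} (hb : b ∈ K) (hb0 : counit (R := k) b = 0) :
    b * y ∈ augIdeal K := by
  obtain ⟨m, s, hs, hsspan⟩ := exists_comatrix k H
  refine mem_of_forall_comatrix_mem hsspan ((augIdeal K).restrictScalars k)
    (f := LinearMap.mulLeft k b) (fun i j ↦ ?_) y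
  have h : b * s i j = ∑ l, s i l * adL k H b (comul (R := k) (s l j)) := by
    calc b * s i j = ∑ q, (∑ l, s i l * antipode k (s l q)) * b * s q j := by
          simp [hs.sum_mul_antipode]
      _ = _ := by
          simp only [adL, hs.comul_eq, map_sum, LinearMap.comp_apply, TensorProduct.map_tmul,
            LinearMap.id_apply, LinearMap.mulRight_apply, LinearMap.mul'_apply, Finset.sum_mul,
            Finset.mul_sum, mul_assoc]
          exact Finset.sum_comm
  rw [LinearMap.mulLeft_apply, h]
  refine sum_mem fun l _ ↦ (augIdeal K).mul_mem_left _ (mem_augIdeal (hN b hb _).1 ?_)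
  simp [adL, hs.comul_eq, hb0]

lemma isTwoSided_augIdeal : (augIdeal K).IsTwoSided where
  mul_mem_of_left y hx := by
    induction hx using Submodule.span_induction with
    | mem b hb => exact mul_mem_augIdeal_of_normal hN y hb.1 hb.2
    | zero => simp
    | add x z _ _ hx hz => rw [add_mul]; exact add_mem hx hz
    | smul a x _ hx => rw [smul_eq_mul, mul_assoc]; exact Ideal.mul_mem_left _ _ hx

lemma mem_augRight_of_mem_augIdeal {z : H} (hz : z ∈ augIdeal K) : z ∈ augRight K := by
  induction hz using Submodule.span_induction with
  | mem b hb => simpa using mul_mem_augRight hb.1 hb.2 1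
  | zero => simp
  | add x z _ _ hx hz => exact add_mem hx hz
  | smul a x hx' hx =>
    clear hx'
    rw [smul_eq_mul]
    induction hx using Submodule.span_induction with
    | mem z hz =>
      obtain ⟨b, hb, hb0, y, rfl⟩ := hz
      rw [← mul_assoc]
      exact augRight_mul_mem (mul_mem_augRight_of_normal hN a hb hb0) _
    | zero => simp
    | add x z _ _ hx hz => rw [mul_add]; exact add_mem hx hz
    | smul c x _ hx => rw [mul_smul_comm]; exact Submodule.smul_mem _ _ hx

lemma isHopfIdeal_augIdeal {n : ℕ} {t : Fin n → Fin n → H} (ht : IsComatrix (k := k) t)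
    (hspan : Submodule.span k (Set.range fun p : Fin n × Fin n ↦ t p.1 p.2) = K.toSubmodule)
    (hS : ∀ x ∈ K, antipode k x ∈ K) : (augIdeal K).IsHopfIdeal k where
  counit_eq_zero x hx := by
    have h : augIdeal K ≤ RingHom.ker (Bialgebra.counitAlgHom k H) :=
      Ideal.span_le.2 fun b hb ↦ hb.2
    exact h hx
  map_mkQ_comul_eq_zero x hx := by
    have := isTwoSided_augIdeal hN
    let g : H →ₐ[k] (H ⧸ augIdeal K) ⊗[k] (H ⧸ augIdeal K) :=
      (Algebra.TensorProduct.map (Ideal.Quotient.mkₐ k (augIdeal K))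
        (Ideal.Quotient.mkₐ k (augIdeal K))).comp (Bialgebra.comulAlgHom k H)
    have h : augIdeal K ≤ RingHom.ker g := by
      refine Ideal.span_le.2 fun b hb ↦ ?_
      have h1 : g b = counit (R := k) b • 1 := by
        refine LinearMap.eq_of_comatrix (f := g.toLinearMap)
          (g := LinearMap.toSpanSingleton k _ 1 ∘ₗ counit) hspan (fun i j ↦ ?_) hb.1
        simp [g, ht.comul_eq, ht.counit_eq, mk_augIdeal_eq (comatrix_mem hspan _ _),
          TensorProduct.ite_tmul, TensorProduct.tmul_ite, Algebra.TensorProduct.one_def]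
      simp [h1, hb.2]
    exact h hx
  antipode_mem x hx := by
    have := isTwoSided_augIdeal hN
    induction hx using Submodule.span_induction with
    | mem b hb => exact mem_augIdeal (hS b hb.1) (by simp [hb.2])
    | zero => simp
    | add x z _ _ hx hz => rw [map_add]; exact add_mem hx hz
    | smul a x _ hx =>
      rw [smul_eq_mul, antipode_mul_antidistrib]
      exact Ideal.mul_mem_right _ _ hx

end Normal

/-- `u ⊗ v ↦ (x ↦ x τ(u) ⊗ v)`. -/
def mulAntipodeTmul (K : Subalgebra k H) :
    H ⊗[k] H →ₗ[k] H →ₗ[k] ((H ⊗[k] H) ⧸ relK k H K) :=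
  TensorProduct.lift (LinearMap.mk₂ k
    (fun u v ↦ (relK k H K).mkQ ∘ₗ (TensorProduct.mk k H H).flip v ∘ₗ
      LinearMap.mulRight k (antipode k u))
    (fun u u' v ↦ by ext; simp [mul_add])
    (fun c u v ↦ by ext; simp)
    (fun u v v' ↦ by ext; simp)
    (fun c u v ↦ by ext; simp))

lemma mulAntipodeTmul_tmul (u v x : H) : mulAntipodeTmul K (u ⊗ₜ v) x =
    (relK k H K).mkQ ((x * antipode k u) ⊗ₜ[k] v) := by
  simp [mulAntipodeTmul]

lemma mkQ_mul_tmul {b : H} (hb : b ∈ K) (x y : H) :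
    (relK k H K).mkQ ((x * b) ⊗ₜ[k] y) = (relK k H K).mkQ (x ⊗ₜ[k] (b * y)) := by
  rw [← sub_eq_zero, ← map_sub]
  exact (Submodule.Quotient.mk_eq_zero _).2 (Submodule.subset_span ⟨x, y, b, hb, rfl⟩)

lemma mulAntipodeTmul_comul_mul {n : ℕ} {t : Fin n → Fin n → H} (ht : IsComatrix (k := k) t)
    (hspan : Submodule.span k (Set.range fun p : Fin n × Fin n ↦ t p.1 p.2) = K.toSubmodule)
    {b : H} (hb : b ∈ K) (y : H) : mulAntipodeTmul K (comul (R := k) (b * y)) =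
      counit (R := k) b • mulAntipodeTmul K (comul (R := k) y) := by
  refine LinearMap.eq_of_comatrix
    (f := mulAntipodeTmul K ∘ₗ comul ∘ₗ LinearMap.mulRight k y)
    (g := LinearMap.toSpanSingleton k _ (mulAntipodeTmul K (comul (R := k) y)) ∘ₗ counit)
    hspan (fun i j ↦ ?_) hb
  have hz (z : H ⊗[k] H) : ∑ l, mulAntipodeTmul K (t i l ⊗ₜ[k] t l j * z) =
      (if i = j then (1 : k) else 0) • mulAntipodeTmul K z := by
    induction z with
    | zero => simp
    | tmul u v =>
      refine LinearMap.ext fun x ↦ ?_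
      calc _ = (relK k H K).mkQ
            ((x * antipode k u * ∑ l, antipode k (t i l) * t l j) ⊗ₜ[k] v) := by
            simp only [LinearMap.sum_apply, Algebra.TensorProduct.tmul_mul_tmul,
              mulAntipodeTmul_tmul, antipode_mul_antidistrib,
              ← mkQ_mul_tmul (comatrix_mem hspan _ _), Finset.mul_sum, TensorProduct.sum_tmul,
              map_sum, mul_assoc]
        _ = _ := by
            rw [ht.sum_antipode_mul]
            split_ifs <;> simp [mulAntipodeTmul_tmul]
    | add x y hx hy => simp only [mul_add, map_add, smul_add, Finset.sum_add_distrib, hx, hy]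
  simpa [Bialgebra.comul_mul, ht.comul_eq, ht.counit_eq, Finset.sum_mul] using
    hz (comul (R := k) y)

section Coaction

variable [(augIdeal K).IsTwoSided]

variable (K) in
/-- The coaction `h ↦ h₍₁₎ ⊗ π(h₍₂₎)` of `H / HK⁺` on `H`. -/
def quotCoaction : H →ₐ[k] H ⊗[k] (H ⧸ augIdeal K) :=
  (Algebra.TensorProduct.map (.id k H) (Ideal.Quotient.mkₐ k (augIdeal K))).comp
    (Bialgebra.comulAlgHom k H)

lemma IsComatrix.quotCoaction_eq {ι : Type*} [Fintype ι] [DecidableEq ι] {s : ι → ι → H}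
    (hs : IsComatrix (k := k) s) (i j : ι) :
    quotCoaction K (s i j) = ∑ l, s i l ⊗ₜ[k] Ideal.Quotient.mk (augIdeal K) (s l j) := by
  simp [quotCoaction, hs.comul_eq]

lemma quotCoaction_eq_of_mem {n : ℕ} {t : Fin n → Fin n → H} (ht : IsComatrix (k := k) t)
    (hspan : Submodule.span k (Set.range fun p : Fin n × Fin n ↦ t p.1 p.2) = K.toSubmodule)
    {b : H} (hb : b ∈ K) : quotCoaction K b = b ⊗ₜ[k] 1 := by
  refine LinearMap.eq_of_comatrix (f := (quotCoaction K).toLinearMap)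
    (g := (TensorProduct.mk k H (H ⧸ augIdeal K)).flip 1) hspan (fun i j ↦ ?_) hb
  simp [ht.quotCoaction_eq, ht.counit_eq, mk_augIdeal_eq (comatrix_mem hspan _ _),
    TensorProduct.tmul_ite]

lemma mem_of_quotCoaction_eq [FiniteDimensional k H] {p : H →ₗ[k] H} (hpK : ∀ h, p h ∈ K)
    (hp1 : p 1 = 1) (hp : ∀ z ∈ augIdeal K, antipodeConv p z = 0) {h : H}
    (hh : quotCoaction K h = h ⊗ₜ[k] 1) : h ∈ K := by
  let θ : (H ⧸ augIdeal K) →ₗ[k] H :=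
    ((augIdeal K).restrictScalars k).liftQ (antipodeConv p) hp
  have hθ (y : H) : θ (Ideal.Quotient.mk _ y) = antipodeConv p y := rfl
  have hz (z : H ⊗[k] H) : LinearMap.lTensor H θ (Algebra.TensorProduct.map (.id k H)
      (Ideal.Quotient.mkₐ k (augIdeal K)) z) = LinearMap.lTensor H (antipodeConv p) z := by
    induction z with
    | zero => simp
    | tmul x y => simp [hθ]
    | add x y hx hy => simp only [map_add, hx, hy]
  have h1 : p h = h := by
    rw [← mul_antipodeConv_comul, ← hz]
    change LinearMap.mul' k H (LinearMap.lTensor H θ (quotCoaction K h)) = h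
    rw [hh, ← map_one (Ideal.Quotient.mk (augIdeal K))]
    simp [hθ, antipodeConv_one hp1, -map_one]
  exact h1 ▸ hpK h

/-- The Galois map `x ⊗ y ↦ x y₍₁₎ ⊗ π(y₍₂₎)`. -/
def quotGalois (hK : ∀ b ∈ K, quotCoaction K b = b ⊗ₜ[k] 1) :
    ((H ⊗[k] H) ⧸ relK k H K) →ₗ[k] H ⊗[k] (H ⧸ augIdeal K) :=
  (relK k H K).liftQ (TensorProduct.lift ((LinearMap.mul k (H ⊗[k] (H ⧸ augIdeal K))).compl₁₂
    (Algebra.TensorProduct.includeLeft : H →ₐ[k] H ⊗[k] (H ⧸ augIdeal K)).toLinearMap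
    (quotCoaction K).toLinearMap)) <| by
    refine Submodule.span_le.2 ?_
    rintro _ ⟨x, y, b, hb, rfl⟩
    simp [hK b hb, ← mul_assoc]

lemma quotGalois_mkQ_tmul (hK : ∀ b ∈ K, quotCoaction K b = b ⊗ₜ[k] 1) (x y : H) :
    quotGalois hK ((relK k H K).mkQ (x ⊗ₜ[k] y)) = x ⊗ₜ[k] 1 * quotCoaction K y :=
  Submodule.liftQ_apply _ _ _

lemma bijective_quotGalois [FiniteDimensional k H] {n : ℕ} {t : Fin n → Fin n → H}
    (ht : IsComatrix (k := k) t)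
    (hspan : Submodule.span k (Set.range fun p : Fin n × Fin n ↦ t p.1 p.2) = K.toSubmodule)
    (hK : ∀ b ∈ K, quotCoaction K b = b ⊗ₜ[k] 1) (hI : ∀ z ∈ augIdeal K, z ∈ augRight K) :
    Function.Bijective (quotGalois hK) := by
  obtain ⟨m, s, hs, hsspan⟩ := exists_comatrix k H
  have hker : (augIdeal K).restrictScalars k ≤
      LinearMap.ker (mulAntipodeTmul K ∘ₗ comul (R := k)) := by
    refine le_trans (b := augRight K) hI (Submodule.span_le.2 ?_)
    rintro _ ⟨b, hb, hb0, y, rfl⟩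
    simp [-Bialgebra.comul_mul, mulAntipodeTmul_comul_mul ht hspan hb, hb0]
  let L : (H ⧸ augIdeal K) →ₗ[k] H →ₗ[k] ((H ⊗[k] H) ⧸ relK k H K) :=
    ((augIdeal K).restrictScalars k).liftQ _ hker
  have hL (i j) (x : H) : L (Ideal.Quotient.mk _ (s i j)) x =
      ∑ l, (relK k H K).mkQ ((x * antipode k (s i l)) ⊗ₜ[k] s l j) := by
    change mulAntipodeTmul K (comul (R := k) (s i j)) x = _
    simp [hs.comul_eq, mulAntipodeTmul_tmul]
  let γ : H ⊗[k] (H ⧸ augIdeal K) →ₗ[k] ((H ⊗[k] H) ⧸ relK k H K) := TensorProduct.lift L.flip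
  have hγ (x : H) (w) : γ (x ⊗ₜ w) = L w x := by simp [γ]
  constructor
  · refine Function.LeftInverse.injective (g := γ) fun m ↦ ?_
    obtain ⟨z, rfl⟩ := (relK k H K).mkQ_surjective m
    induction z with
    | zero => simp
    | tmul x y =>
      suffices h : γ ∘ₗ quotGalois hK ∘ₗ (relK k H K).mkQ ∘ₗ TensorProduct.mk k H H x =
          (relK k H K).mkQ ∘ₗ TensorProduct.mk k H H x from congr($h y)
      refine LinearMap.ext_of_span hsspan fun i j ↦ ?_
      calc γ (quotGalois hK ((relK k H K).mkQ (x ⊗ₜ s i j)))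
          = ∑ l, (relK k H K).mkQ ((x * ∑ q, s i q * antipode k (s q l)) ⊗ₜ[k] s l j) := by
            simp only [quotGalois_mkQ_tmul, hs.quotCoaction_eq, Finset.mul_sum,
              Algebra.TensorProduct.tmul_mul_tmul, one_mul, map_sum, hγ, hL,
              TensorProduct.sum_tmul, mul_assoc]
            exact Finset.sum_comm
        _ = (relK k H K).mkQ (x ⊗ₜ s i j) := by
            simp only [hs.sum_mul_antipode, mul_ite, mul_one, mul_zero, TensorProduct.ite_tmul,
              apply_ite (relK k H K).mkQ, map_zero, Finset.sum_ite_eq,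
              Finset.mem_univ, if_true]
    | add x y hx hy => simp only [map_add, hx, hy]
  · rw [← LinearMap.range_eq_top, eq_top_iff]
    rintro z -
    induction z with
    | zero => exact zero_mem _
    | tmul x w =>
      obtain ⟨y, rfl⟩ := Ideal.Quotient.mk_surjective w
      refine mem_of_forall_comatrix_mem hsspan (LinearMap.range (quotGalois hK))
        (f := TensorProduct.mk k H (H ⧸ augIdeal K) x ∘ₗ
          (Ideal.Quotient.mkₐ k (augIdeal K)).toLinearMap) (fun i j ↦ ?_) y
      refine ⟨∑ l, (relK k H K).mkQ ((x * antipode k (s i l)) ⊗ₜ[k] s l j), ?_⟩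
      calc _ = ∑ q, (x * ∑ l, antipode k (s i l) * s l q) ⊗ₜ[k]
              Ideal.Quotient.mk (augIdeal K) (s q j) := by
            simp only [quotGalois_mkQ_tmul, hs.quotCoaction_eq, Finset.mul_sum,
              Algebra.TensorProduct.tmul_mul_tmul, one_mul, map_sum,
              TensorProduct.sum_tmul, mul_assoc]
            exact Finset.sum_comm
        _ = x ⊗ₜ[k] Ideal.Quotient.mk (augIdeal K) (s i j) := by
            simp [hs.sum_antipode_mul, TensorProduct.ite_tmul]
    | add x y hx hy => exact add_mem hx hy

end Coaction

lemma nonempty_galoisExt_of_normal [FiniteDimensional k H]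
    (hΔ : ∀ x ∈ K, comul (R := k) x ∈
      LinearMap.range (TensorProduct.map K.val.toLinearMap K.val.toLinearMap))
    (hS : ∀ x ∈ K, antipode k x ∈ K)
    (hN : ∀ x ∈ K, ∀ a : H,
      adL k H x (comul (R := k) a) ∈ K ∧ adR k H x (comul (R := k) a) ∈ K) :
    Nonempty (GaloisExt k H K) := by
  obtain ⟨n, t, ht, hspan⟩ := exists_subalgebra_comatrix K hΔ hS
  obtain ⟨p, hpK, hp1, hpm⟩ := exists_subalgebra_retraction K hΔ hS
  obtain ⟨m, s, hs, hsspan⟩ := exists_comatrix k H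
  have := isTwoSided_augIdeal hN
  have := isHopfIdeal_augIdeal hN ht hspan hS
  have hI : ∀ z ∈ augIdeal K, z ∈ augRight K := fun z hz ↦ mem_augRight_of_mem_augIdeal hN hz
  have hK : ∀ b ∈ K, quotCoaction K b = b ⊗ₜ[k] 1 :=
    fun b hb ↦ quotCoaction_eq_of_mem ht hspan hb
  exact ⟨{
    W := H ⧸ augIdeal K
    finW := Module.Finite.of_surjective (Ideal.Quotient.mkₐ k (augIdeal K)).toLinearMap
      Ideal.Quotient.mk_surjective
    ρ := quotCoaction K
    coassoc := fun h ↦ by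
      suffices h1 : (TensorProduct.assoc k H (H ⧸ augIdeal K) (H ⧸ augIdeal K)).toLinearMap ∘ₗ
          LinearMap.rTensor (H ⧸ augIdeal K) (quotCoaction K).toLinearMap ∘ₗ
            (quotCoaction K).toLinearMap =
          LinearMap.lTensor H comul ∘ₗ (quotCoaction K).toLinearMap from congr($h1 h)
      refine LinearMap.ext_of_span hsspan fun i j ↦ ?_
      simp only [LinearMap.comp_apply, AlgHom.toLinearMap_apply, hs.quotCoaction_eq, map_sum,
        LinearMap.rTensor_tmul, LinearMap.lTensor_tmul, TensorProduct.sum_tmul,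
        TensorProduct.tmul_sum, LinearEquiv.coe_coe, TensorProduct.assoc_tmul,
        Bialgebra.Quotient.comul_mk, hs.comul_eq, TensorProduct.map_tmul,
        Ideal.Quotient.mkₐ_eq_mk]
      exact Finset.sum_comm
    counital := fun h ↦ by
      suffices h1 : (TensorProduct.rid k H).toLinearMap ∘ₗ LinearMap.lTensor H counit ∘ₗ
          (quotCoaction K).toLinearMap = LinearMap.id from congr($h1 h)
      refine LinearMap.ext_of_span hsspan fun i j ↦ ?_
      simp [hs.quotCoaction_eq, hs.counit_eq]
    coinv := fun h ↦ ⟨mem_of_quotCoaction_eq hpK hp1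
      fun z hz ↦ antipodeConv_eq_zero ht hspan hpm (hI z hz), hK h⟩
    β := quotGalois hK
    hβ := quotGalois_mkQ_tmul hK
    bij := bijective_quotGalois ht hspan hK hI }⟩

end

/-- a Hopf subalgebra `K` of a finite-dimensional Hopf algebra `H` over a field
is normal if and only if `H | K` is a Hopf-Galois extension. -/
theorem statement6 (H : Type v) [Ring H] [HopfAlgebra k H] [FiniteDimensional k H]
    (K : Subalgebra k H)
    -- `K` is a Hopf subalgebra: `Δ(K)` lies in the image of `K ⊗ K` in `H ⊗ H` ...
    (hΔ : ∀ x ∈ K, Coalgebra.comul (R := k) x ∈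
      LinearMap.range (TensorProduct.map K.val.toLinearMap K.val.toLinearMap))
    -- ... and `K` is stable under the antipode
    (hS : ∀ x ∈ K, HopfAlgebra.antipode (R := k) x ∈ K) :
    -- `K` is normal in `H` ...
    (∀ x ∈ K, ∀ a : H,
        adL k H x (Coalgebra.comul (R := k) a) ∈ K ∧
        adR k H x (Coalgebra.comul (R := k) a) ∈ K)
    -- ... iff `H | K` is a Hopf-Galois extension
      ↔ Nonempty (GaloisExt k H K) :=
  ⟨nonempty_galoisExt_of_normal hΔ hS, fun ⟨G⟩ ↦
    normal_of_mul_mem_augRight hΔ hS fun y _ hb hb0 ↦ G.mul_mem_augRight y hb hb0⟩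
end
end
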